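/- arXiv:2101.07749 — 7 statements merged into one kernel-verified Lean document; each statement's English description precedes it below -/
import Mathlib

section
/- If Θ is not the identity automorphism of F, then the center of the group A(m,Θ) is exactly the set {(0,b) : b ∈ F}, and the map b ↦ (0,b) is an isomorphism from the additive group of F onto the center; in particular the center is an elementary abelian 2-group of order 2^m. -/
/-- The underlying set of the Suzuki 2-group `A(m,Θ)`: pairs `(a, b)` of elements of `F`,
with multiplication `(a,c)·(b,d) = (a+b, c+d+b·Θ(a))`. -/
@[ext]
structure Suzuki (F : Type*) [Field F] (Θ : F ≃+* F) where
  a : F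
  b : F

namespace Suzuki

variable {F : Type*} [Field F] {Θ : F ≃+* F}

instance : Mul (Suzuki F Θ) := ⟨fun x y => ⟨x.a + y.a, x.b + y.b + y.a * Θ x.a⟩⟩
instance : One (Suzuki F Θ) := ⟨⟨0, 0⟩⟩
instance : Inv (Suzuki F Θ) := ⟨fun x => ⟨-x.a, -x.b + x.a * Θ x.a⟩⟩

@[simp] lemma mul_a (x y : Suzuki F Θ) : (x * y).a = x.a + y.a := rfl
@[simp] lemma mul_b (x y : Suzuki F Θ) : (x * y).b = x.b + y.b + y.a * Θ x.a := rfl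
@[simp] lemma one_a : (1 : Suzuki F Θ).a = 0 := rfl
@[simp] lemma one_b : (1 : Suzuki F Θ).b = 0 := rfl
@[simp] lemma inv_a (x : Suzuki F Θ) : (x⁻¹).a = -x.a := rfl
@[simp] lemma inv_b (x : Suzuki F Θ) : (x⁻¹).b = -x.b + x.a * Θ x.a := rfl

/-- The Suzuki 2-group `A(m,Θ)`. -/
instance : Group (Suzuki F Θ) where
  mul_assoc x y z := by ext <;> simp [map_add] <;> ring
  one_mul x := by ext <;> simp
  mul_one x := by ext <;> simp
  inv_mul_cancel x := by ext <;> simp [map_neg]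

end Suzuki

namespace Suzuki

variable {F : Type*} [Field F] {Θ : F ≃+* F}

lemma mem_center_iff_a_eq_zero (hΘ : Θ ≠ RingEquiv.refl F) (x : Suzuki F Θ) :
    x ∈ Subgroup.center (Suzuki F Θ) ↔ x.a = 0 := by
  rw [Subgroup.mem_center_iff]
  constructor
  · intro h
    have comm (t : F) : x.a * Θ t = t * Θ x.a := by
      have := congrArg Suzuki.b (h ⟨t, 0⟩)
      simp only [mul_b] at this
      linear_combination this
    by_contra hx
    have fixed : Θ x.a = x.a := by simpa using (comm 1).symm
    refine hΘ (RingEquiv.ext fun t => mul_left_cancel₀ hx ?_)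
    rw [comm t, fixed, mul_comm, RingEquiv.refl_apply]
  · intro hx y
    ext <;> simp [hx, add_comm]

/-- The isomorphism `b ↦ (0, b)` from the additive group of `F` onto the center. -/
def centerEquiv (hΘ : Θ ≠ RingEquiv.refl F) :
    Multiplicative F ≃* Subgroup.center (Suzuki F Θ) where
  toFun b := ⟨⟨0, b.toAdd⟩, (mem_center_iff_a_eq_zero hΘ _).2 rfl⟩
  invFun z := Multiplicative.ofAdd z.1.b
  left_inv _ := rfl
  right_inv z := Subtype.ext (Suzuki.ext ((mem_center_iff_a_eq_zero hΘ _).1 z.2).symm rfl)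
  map_mul' _ _ := Subtype.ext (by ext <;> simp)

end Suzuki

lemma two_eq_zero_of_natCard_eq_two_pow {F : Type*} [Field F] {m : ℕ}
    (hF : Nat.card F = 2 ^ m) : (2 : F) = 0 := by
  have : Finite F := Nat.finite_of_card_ne_zero (by simp [hF])
  have := Fintype.ofFinite F
  have h : ((Nat.card F : ℕ) : F) = 0 := by
    rw [Nat.card_eq_fintype_card, Nat.cast_card_eq_zero]
  rw [hF, Nat.cast_pow, Nat.cast_ofNat] at h
  exact eq_zero_of_pow_eq_zero h

/-- If `Θ` is not the identity automorphism of `F`, then the center of the group `A(m,Θ)` is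
exactly the set `{(0,b) : b ∈ F}`, and the map `b ↦ (0,b)` is an isomorphism from the additive
group of `F` onto the center; in particular the center is an elementary abelian `2`-group of
order `2^m`. -/
theorem Suzuki.center_eq (m : ℕ) (hm : 3 ≤ m) (hodd : Odd m)
    (F : Type*) [Field F] (hF : Nat.card F = 2 ^ m) (Θ : F ≃+* F)
    (hΘ : Θ ≠ RingEquiv.refl F) :
    ((Subgroup.center (Suzuki F Θ) : Set (Suzuki F Θ)) = {g : Suzuki F Θ | g.a = 0}) ∧
    (∃ e : Multiplicative F ≃* Subgroup.center (Suzuki F Θ),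
      ∀ b : F, ((e (Multiplicative.ofAdd b) : Subgroup.center (Suzuki F Θ)) : Suzuki F Θ)
        = ⟨0, b⟩) ∧
    Nat.card (Subgroup.center (Suzuki F Θ)) = 2 ^ m ∧
    (∀ z ∈ Subgroup.center (Suzuki F Θ), z ^ 2 = 1) := by
  refine ⟨Set.ext fun x => mem_center_iff_a_eq_zero hΘ x, ⟨centerEquiv hΘ, fun _ => rfl⟩, ?_, ?_⟩
  · rw [← Nat.card_congr (centerEquiv hΘ).toEquiv]
    exact hF
  · intro z hz
    have ha := (mem_center_iff_a_eq_zero hΘ z).1 hz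
    rw [sq]
    ext
    · simp [ha]
    · simp [ha, ← two_mul, two_eq_zero_of_natCard_eq_two_pow hF]
end

section
/- When m = 2n+1 with n ≥ 1 and Θ is the automorphism x ↦ x^(2^(n+1)) of F, the derived (commutator) subgroup of A(m,Θ) is equal to the center of A(m,Θ), namely the subgroup {(0,b) : b ∈ F}. -/
namespace Suzuki

open scoped commutatorElement

variable {F : Type*} [Field F] {Θ : F ≃+* F}

lemma commutatorElement_a (x y : Suzuki F Θ) : ⁅x, y⁆.a = 0 := by
  simp [commutatorElement_def]

lemma commutatorElement_b (x y : Suzuki F Θ) :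
    ⁅x, y⁆.b = y.a * Θ x.a - x.a * Θ y.a := by
  simp [commutatorElement_def]
  ring

/-- The center consists of the pairs `(0, b)` as soon as `Θ` is nontrivial. -/
lemma mem_center_iff_of_ne {t : F} (ht : Θ t ≠ t) (g : Suzuki F Θ) :
    g ∈ Subgroup.center (Suzuki F Θ) ↔ g.a = 0 := by
  rw [Subgroup.mem_center_iff]
  refine ⟨fun h => ?_, fun h k => by ext <;> simp [h, add_comm]⟩
  have key (y : F) : g.a * Θ y = y * Θ g.a := by
    have := congrArg Suzuki.b (h ⟨y, 0⟩)
    simpa using this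
  by_contra hg
  have fixed : Θ g.a = g.a := by simpa using (key 1).symm
  refine ht (mul_left_cancel₀ hg ?_)
  rw [key t, fixed, mul_comm]

/-- If `Θ` squares to the Frobenius map `x ↦ x ^ 2`, then `a ↦ a * Θ a` is surjective. -/
lemma exists_mul_map_self_eq (hsq : ∀ x : F, Θ (Θ x) = x ^ 2) (d : F) :
    ∃ a : F, a * Θ a = d := by
  rcases eq_or_ne d 0 with rfl | hd
  · exact ⟨0, by simp⟩
  · have hΘd : Θ d ≠ 0 := by simpa using hd
    refine ⟨Θ d / d, ?_⟩
    rw [map_div₀, hsq]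
    field_simp

/-- If `Θ` is nontrivial and squares to the Frobenius map, every pair `(0, b)` is a
commutator. -/
lemma exists_commutatorElement_eq (hsq : ∀ x : F, Θ (Θ x) = x ^ 2) {t : F} (ht : Θ t ≠ t)
    {g : Suzuki F Θ} (hg : g.a = 0) : ∃ x y : Suzuki F Θ, ⁅x, y⁆ = g := by
  have hu : t - Θ t ≠ 0 := sub_ne_zero.mpr ht.symm
  obtain ⟨a, ha⟩ := exists_mul_map_self_eq hsq (g.b / (t - Θ t))
  refine ⟨⟨a, 0⟩, ⟨t * a, 0⟩, Suzuki.ext ?_ ?_⟩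
  · rw [commutatorElement_a, hg]
  · rw [commutatorElement_b, map_mul]
    calc t * a * Θ a - a * (Θ t * Θ a) = a * Θ a * (t - Θ t) := by ring
      _ = g.b := by rw [ha, div_mul_cancel₀ _ hu]

/-- A field with more than two elements has an element moved by any `Θ` squaring to the
Frobenius map. -/
lemma exists_map_ne_self (hsq : ∀ x : F, Θ (Θ x) = x ^ 2) (hF : 2 < Nat.card F) :
    ∃ t : F, Θ t ≠ t := by
  by_contra! h
  have hsub : (Set.univ : Set F) ⊆ {0, 1} := fun x _ => by
    have hx : x ^ 2 = x := by rw [← hsq, h, h]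
    rcases eq_or_ne x 0 with h0 | h0
    · exact Or.inl h0
    · exact Or.inr (mul_left_cancel₀ h0 (by rw [← sq, hx, mul_one]))
  have hcard := Set.ncard_le_ncard hsub (by simp)
  rw [Set.ncard_univ, Set.ncard_pair zero_ne_one] at hcard
  omega

end Suzuki

/-- When `m = 2n+1` with `n ≥ 1` and `Θ` is the automorphism `x ↦ x^(2^(n+1))` of `F`, the
derived (commutator) subgroup of `A(m,Θ)` is equal to the center of `A(m,Θ)`, namely the
subgroup `{(0,b) : b ∈ F}`. -/
theorem Suzuki.commutator_eq_center (n : ℕ) (hn : 1 ≤ n)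
    (F : Type*) [Field F] (hF : Nat.card F = 2 ^ (2 * n + 1)) (Θ : F ≃+* F)
    (hΘ : ∀ x : F, Θ x = x ^ (2 ^ (n + 1))) :
    commutator (Suzuki F Θ) = Subgroup.center (Suzuki F Θ) ∧
    ((Subgroup.center (Suzuki F Θ) : Set (Suzuki F Θ)) = {g : Suzuki F Θ | g.a = 0}) := by
  have hfin : Finite F := Nat.finite_of_card_ne_zero (by simp [hF])
  have hsq (x : F) : Θ (Θ x) = x ^ 2 := by
    have := Fintype.ofFinite F
    have hx : x ^ 2 ^ (2 * n + 1) = x := by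
      rw [← hF, Nat.card_eq_fintype_card, FiniteField.pow_card]
    rw [hΘ, hΘ, ← pow_mul, ← pow_add, show n + 1 + (n + 1) = 2 * n + 1 + 1 by ring, pow_succ,
      pow_mul, hx]
  have hcard : 2 < Nat.card F := by
    rw [hF]
    exact lt_self_pow₀ one_lt_two (by omega)
  obtain ⟨t, ht⟩ := exists_map_ne_self hsq hcard
  refine ⟨le_antisymm ?_ fun g hg => ?_, Set.ext (mem_center_iff_of_ne ht)⟩
  · rw [commutator_def, Subgroup.commutator_le]
    exact fun x _ y _ => (mem_center_iff_of_ne ht _).mpr (commutatorElement_a x y)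
  · obtain ⟨x, y, rfl⟩ := exists_commutatorElement_eq hsq ht ((mem_center_iff_of_ne ht g).mp hg)
    exact Subgroup.commutator_mem_commutator (Subgroup.mem_top x) (Subgroup.mem_top y)
end

section
/- When m = 2n+1 with n ≥ 1 and Θ is the automorphism x ↦ x^(2^(n+1)) of F, the Frattini subgroup of A(m,Θ) is equal to the center of A(m,Θ), namely the subgroup {(0,b) : b ∈ F}. -/
namespace Suzuki

variable {F : Type*} [Field F] {Θ : F ≃+* F}

/-- If `Θ` is nontrivial, the center consists of the elements with zero first coordinate. -/
lemma mem_center_iff (hΘ : ∃ x, Θ x ≠ x) (g : Suzuki F Θ) :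
    g ∈ Subgroup.center (Suzuki F Θ) ↔ g.a = 0 := by
  rw [Subgroup.mem_center_iff]
  constructor
  · intro h
    have hcomm (x : F) : g.a * Θ x = x * Θ g.a := by
      have := congrArg Suzuki.b (h ⟨x, 0⟩)
      simp only [mul_b] at this
      linear_combination this
    have hfix : g.a = Θ g.a := by simpa using hcomm 1
    obtain ⟨x, hx⟩ := hΘ
    by_contra hg
    refine hx (mul_left_cancel₀ hg ?_)
    rw [hcomm x, ← hfix, mul_comm]
  · intro h x
    ext
    · simp [h]
    · simp [h, add_comm]

/-- The projection `A(m,Θ) → F` to the first coordinate. -/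
def fstHom (F : Type*) [Field F] (Θ : F ≃+* F) : Suzuki F Θ →* Multiplicative F where
  toFun g := Multiplicative.ofAdd g.a
  map_one' := rfl
  map_mul' _ _ := rfl

lemma a_eq_zero_of_mem_frattini [CharP F 2] {g : Suzuki F Θ}
    (hg : g ∈ frattini (Suzuki F Θ)) : g.a = 0 := by
  let := ZMod.algebra F 2
  rw [← Module.forall_dual_apply_eq_zero_iff (ZMod 2)]
  intro f
  by_contra hf
  let φ : Suzuki F Θ →* Multiplicative (ZMod 2) :=
    (AddMonoidHom.toMultiplicative f.toAddMonoidHom).comp (fstHom F Θ)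
  have hφ : Function.Surjective φ := by
    intro y
    obtain ⟨x, hx⟩ := LinearMap.surjective (f := f) (fun h => hf (by simp [h])) y.toAdd
    exact ⟨⟨x, 0⟩, congrArg Multiplicative.ofAdd hx⟩
  have : IsSimpleGroup (Multiplicative (ZMod 2)) := isSimpleGroup_of_prime_card (p := 2) (by simp)
  have hmem : φ g ∈ (⊥ : Subgroup (Multiplicative (ZMod 2))) :=
    frattini_le_coatom isCoatom_bot (frattini_le_comap_frattini_of_surjective hφ hg)
  exact hf (congrArg Multiplicative.toAdd (Subgroup.mem_bot.1 hmem))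

lemma mul_self_eq [CharP F 2] (g : Suzuki F Θ) : g * g = ⟨0, g.a * Θ g.a⟩ := by
  ext <;> simp [CharTwo.add_self_eq_zero]

/-- A maximal subgroup contains every central subgroup of exponent two all of whose elements
are squares. -/
lemma _root_.Subgroup.le_of_isCoatom_of_forall_sq {G : Type*} [Group G] {M Z : Subgroup G}
    (hM : IsCoatom M) (hZ : Z ≤ Subgroup.center G) (hexp : ∀ z ∈ Z, z * z = 1)
    (hsq : ∀ z ∈ Z, ∃ g, g * g = z) : Z ≤ M := by
  by_contra h
  have htop : M ⊔ Z = ⊤ := hM.2 _ (left_lt_sup.2 h)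
  have : Z.Normal :=
    ⟨fun z hz g => by rwa [Subgroup.mem_center_iff.1 (hZ hz) g, mul_inv_cancel_right]⟩
  refine h fun z hz => ?_
  obtain ⟨g, rfl⟩ := hsq z hz
  have hg : g ∈ M ⊔ Z := htop ▸ Subgroup.mem_top g
  obtain ⟨x, hx, y, hy, rfl⟩ := Subgroup.mem_sup_of_normal_right.1 hg
  have hxy : x * y * (x * y) = x * x * (y * y) := by
    rw [mul_assoc x y, ← mul_assoc y x, ← Subgroup.mem_center_iff.1 (hZ hy) x]
    simp only [mul_assoc]
  rw [hxy, hexp y hy, mul_one]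
  exact mul_mem hx hx

/-- If `Θ ∘ Θ` is squaring on a finite field `F`, then `x ↦ x * Θ x` is onto. -/
lemma surjective_mul_self_map [Finite F] (hΘ : ∀ x, Θ (Θ x) = x ^ 2) :
    Function.Surjective fun x : F => x * Θ x := by
  refine Finite.surjective_of_injective fun x y (hxy : x * Θ x = y * Θ y) => ?_
  by_cases hy : y = 0
  · simpa [hy] using hxy
  have hΘxy : Θ x * x ^ 2 = Θ y * y ^ 2 := by simpa [hΘ] using congrArg Θ hxy
  have hΘy : Θ y ≠ 0 := by simpa using hy
  refine mul_right_cancel₀ (mul_ne_zero hy hΘy) ?_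
  linear_combination hΘxy - x * hxy

end Suzuki

/-- When `m = 2n+1` with `n ≥ 1` and `Θ` is the automorphism `x ↦ x^(2^(n+1))` of `F`, the
Frattini subgroup of `A(m,Θ)` (the intersection of its maximal subgroups) is equal to the
center of `A(m,Θ)`, namely the subgroup `{(0,b) : b ∈ F}`. -/
theorem Suzuki.frattini_eq_center (n : ℕ) (hn : 1 ≤ n)
    (F : Type*) [Field F] (hF : Nat.card F = 2 ^ (2 * n + 1)) (Θ : F ≃+* F)
    (hΘ : ∀ x : F, Θ x = x ^ (2 ^ (n + 1))) :
    frattini (Suzuki F Θ) = Subgroup.center (Suzuki F Θ) ∧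
    ((Subgroup.center (Suzuki F Θ) : Set (Suzuki F Θ)) = {g : Suzuki F Θ | g.a = 0}) := by
  have : Finite F := Nat.finite_of_card_ne_zero (by simp [hF])
  have := Fintype.ofFinite F
  rw [Nat.card_eq_fintype_card] at hF
  have : CharP F 2 := charP_of_card_eq_prime_pow hF
  have hsq (x : F) : Θ (Θ x) = x ^ 2 := by
    rw [hΘ x, hΘ, ← pow_mul, ← pow_add, show n + 1 + (n + 1) = 2 * n + 1 + 1 by ring,
      pow_succ, ← hF, pow_mul, FiniteField.pow_card]
  have hne : ∃ x, Θ x ≠ x := by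
    by_contra! h
    have h01 (x : F) : x = 0 ∨ x = 1 := by
      have hx := hsq x
      rw [h, h] at hx
      exact IsIdempotentElem.iff_eq_zero_or_one.1 (show x * x = x by rw [← sq, ← hx])
    have hle : Fintype.card F ≤ 2 := by
      classical
      exact (Finset.card_le_card (fun x _ => by simpa using h01 x)).trans
        (Finset.card_le_two (a := (0 : F)) (b := 1))
    have hlt : 2 ^ 1 < 2 ^ (2 * n + 1) := Nat.pow_lt_pow_right one_lt_two (by omega)
    omega
  have hcenter (g : Suzuki F Θ) := mem_center_iff hne g
  refine ⟨le_antisymm (fun g hg => (hcenter g).2 (a_eq_zero_of_mem_frattini hg)) ?_,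
    Set.ext hcenter⟩
  refine le_iInf₂ fun M hM => Subgroup.le_of_isCoatom_of_forall_sq hM le_rfl ?_ ?_
  · intro z hz
    rw [mul_self_eq, (hcenter z).1 hz, zero_mul]
    rfl
  · intro z hz
    obtain ⟨x, hx⟩ := surjective_mul_self_map hsq z.b
    exact ⟨⟨x, 0⟩, by rw [mul_self_eq]; ext; exacts [((hcenter z).1 hz).symm, hx]⟩
end

section
/- Suppose Θ is not the identity automorphism of F and ψ : F → F is a nonzero additive (F₂-linear) map. Then the automorphism φ_ψ of A(m,Θ) does not normalize the subgroup A₂ = {φ_x : x ∈ F^×} of Aut(A(m,Θ)); that is, there exists x ∈ F^× such that φ_ψ⁻¹ ∘ φ_x ∘ φ_ψ is not of the form φ_y for any y ∈ F^×. -/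
namespace Suzuki

variable {F : Type*} [Field F]

/-- `f` is the automorphism `φ_ψ : (a,b) ↦ (a, ψ(a)+b)` of `A(m,Θ)`. -/
def IsPhiAdd (Θ : F ≃+* F) (ψ : F →+ F) (f : MulAut (Suzuki F Θ)) : Prop :=
  ∀ a b : F, f (⟨a, b⟩ : Suzuki F Θ) = ⟨a, ψ a + b⟩

/-- `f` is the automorphism `φ_x : (a,b) ↦ (x·a, x·Θ(x)·b)` of `A(m,Θ)`. -/
def IsPhiMul (Θ : F ≃+* F) (x : Fˣ) (f : MulAut (Suzuki F Θ)) : Prop :=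
  ∀ a b : F, f (⟨a, b⟩ : Suzuki F Θ) = ⟨(x : F) * a, (x : F) * Θ (x : F) * b⟩

/-- `f` is the automorphism `φ_σ : (a,b) ↦ (σ(a), σ(b))` of `A(m,Θ)`. -/
def IsPhiGal (Θ : F ≃+* F) (σ : F ≃+* F) (f : MulAut (Suzuki F Θ)) : Prop :=
  ∀ a b : F, f (⟨a, b⟩ : Suzuki F Θ) = ⟨σ a, σ b⟩

/-- The subgroup `A₂ = {φ_x : x ∈ F^×}` of `Aut(A(m,Θ))`, as a set. -/
def A2 (Θ : F ≃+* F) : Set (MulAut (Suzuki F Θ)) :=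
  {f | ∃ x : Fˣ, IsPhiMul Θ x f}

end Suzuki

namespace Suzuki

variable {F : Type*} [Field F] {Θ : F ≃+* F}

/-- If `φ_ψ⁻¹ ∘ φ_x ∘ φ_ψ = φ_y`, then `ψ` is semilinear for multiplication by `x`. -/
lemma map_mul_of_isPhiMul_conj {ψ : F →+ F} {fψ fx : MulAut (Suzuki F Θ)} {x y : Fˣ}
    (hfψ : IsPhiAdd Θ ψ fψ) (hfx : IsPhiMul Θ x fx) (hy : IsPhiMul Θ y (fψ⁻¹ * fx * fψ))
    (a : F) : ψ (x * a) = x * Θ x * ψ a := by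
  have key (a : F) : (⟨x * a, x * Θ x * ψ a⟩ : Suzuki F Θ)
      = ⟨y * a, ψ (y * a)⟩ := by
    have h := congrArg fψ (hy a 0)
    rw [← MulAut.mul_apply, mul_assoc, mul_inv_cancel_left, MulAut.mul_apply, hfψ, hfψ, hfx] at h
    simpa using h
  have hxy : (x : F) = y := by simpa using congrArg Suzuki.a (key 1)
  rw [hxy]
  simpa [hxy] using (congrArg Suzuki.b (key a)).symm

/-- A nonzero additive map with `ψ (x * a) = x * Θ x * ψ a` for all units `x` forces `Θ = 1`. -/
lemma eq_refl_of_map_mul {ψ : F →+ F} (hψ : ψ ≠ 0)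
    (h : ∀ (x : Fˣ) (a : F), ψ (x * a) = x * Θ x * ψ a) : Θ = RingEquiv.refl F := by
  have hval (x : F) : ψ x = x * Θ x * ψ 1 := by
    rcases eq_or_ne x 0 with rfl | hx
    · simp
    · simpa using h (Units.mk0 x hx) 1
  have hone : ψ 1 ≠ 0 := fun h0 => hψ (by ext x; simp [hval x, h0])
  have hadd (x : F) : x + Θ x = 0 := by
    have hx := map_add ψ x 1
    rw [hval (x + 1), hval x, map_add, map_one, ← sub_eq_zero] at hx
    refine (mul_eq_zero.mp ?_).resolve_right hone
    linear_combination hx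
  have htwo : (1 : F) + 1 = 0 := by simpa using hadd 1
  ext x
  rw [RingEquiv.refl_apply]
  linear_combination hadd x - x * htwo

end Suzuki

/-- Suppose `Θ` is not the identity automorphism of `F` and `ψ : F → F` is a nonzero additive
(`F₂`-linear) map. Then the automorphism `φ_ψ` of `A(m,Θ)` does not normalize the subgroup
`A₂ = {φ_x : x ∈ F^×}` of `Aut(A(m,Θ))`; that is, there exists `x ∈ F^×` such that
`φ_ψ⁻¹ ∘ φ_x ∘ φ_ψ` is not of the form `φ_y` for any `y ∈ F^×`. -/
theorem Suzuki.phiAdd_not_normalizes_A2 (m : ℕ) (hm : 3 ≤ m) (hodd : Odd m)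
    (F : Type*) [Field F] (hF : Nat.card F = 2 ^ m) (Θ : F ≃+* F)
    (hΘ : Θ ≠ RingEquiv.refl F) (ψ : F →+ F) (hψ : ψ ≠ 0)
    (fψ : MulAut (Suzuki F Θ)) (hfψ : Suzuki.IsPhiAdd Θ ψ fψ) :
    ∃ x : Fˣ, ∀ fx : MulAut (Suzuki F Θ), Suzuki.IsPhiMul Θ x fx →
      ∀ y : Fˣ, ¬ Suzuki.IsPhiMul Θ y (fψ⁻¹ * fx * fψ) := by
  by_contra! hall
  refine hΘ (Suzuki.eq_refl_of_map_mul hψ fun x a => ?_)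
  obtain ⟨fx, hfx, y, hy⟩ := hall x
  exact Suzuki.map_mul_of_isPhiMul_conj hfψ hfx hy a
end

section
/- Suppose Θ is not the identity automorphism of F. Let ψ : F → F be an additive (F₂-linear) map, let x ∈ F^×, and let σ be a ring automorphism of F. Then the automorphism φ_ψ ∘ φ_x ∘ φ_σ of A(m,Θ) normalizes the subgroup A₂ = {φ_y : y ∈ F^×} of Aut(A(m,Θ)) if and only if ψ = 0. -/
namespace Suzuki

variable {F : Type*} [Field F] {Θ : F ≃+* F}

/-- The automorphism `φ_y : (a,b) ↦ (y·a, y·Θ(y)·b)`. -/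
def phiMul (Θ : F ≃+* F) (y : Fˣ) : MulAut (Suzuki F Θ) where
  toFun p := ⟨(y : F) * p.a, (y : F) * Θ (y : F) * p.b⟩
  invFun p := ⟨(y : F)⁻¹ * p.a, ((y : F) * Θ (y : F))⁻¹ * p.b⟩
  left_inv p := by
    have h : Θ (y : F) ≠ 0 := by simp
    ext <;> simp; field_simp
  right_inv p := by
    have h : Θ (y : F) ≠ 0 := by simp
    ext <;> simp; field_simp
  map_mul' p q := by ext <;> simp <;> ring

lemma isPhiMul_phiMul (y : Fˣ) : IsPhiMul Θ y (phiMul Θ y) := fun _ _ => rfl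

/-- If `φ_σ` is multiplicative then `σ` commutes with `Θ`. -/
lemma IsPhiGal.commute {σ : F ≃+* F} {f : MulAut (Suzuki F Θ)} (hf : IsPhiGal Θ σ f) (a : F) :
    σ (Θ a) = Θ (σ a) := by
  have h := congrArg Suzuki.b (map_mul f ⟨a, 0⟩ ⟨1, 0⟩)
  rw [show (⟨a, 0⟩ * ⟨1, 0⟩ : Suzuki F Θ) = ⟨a + 1, Θ a⟩ by ext <;> simp] at h
  simpa [hf _ _] using h

lemma isPhiMul_conj_iff (g f : MulAut (Suzuki F Θ)) (w : Fˣ) :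
    IsPhiMul Θ w (g * f * g⁻¹) ↔ ∀ p, g (f p) = phiMul Θ w (g p) := by
  constructor
  · intro h p
    have hp : (g * f * g⁻¹) (g p) = phiMul Θ w (g p) := h (g p).a (g p).b
    simpa using hp
  · intro h a b
    simpa [phiMul] using h (g⁻¹ ⟨a, b⟩)

/-- An additive map that scales like `ψ(z·a) = z·Θ(z)·ψ(a)` vanishes unless `Θ` is trivial. -/
lemma eq_zero_of_map_mul (hΘ : Θ ≠ RingEquiv.refl F) {ψ : F →+ F}
    (h : ∀ (z : Fˣ) (a : F), ψ (z * a) = z * Θ z * ψ a) : ψ = 0 := by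
  have hψ (z : F) : ψ z = z * Θ z * ψ 1 := by
    by_cases hz : z = 0
    · simp [hz]
    · simpa using h (Units.mk0 z hz) 1
  have hψ_one : ψ 1 = 0 := by
    by_contra hc
    have hneg (z : F) : z + Θ z = 0 := by
      have h1 := hψ (z + 1)
      rw [map_add, hψ z, map_add, map_one Θ] at h1
      apply (mul_eq_zero.mp (_ : (z + Θ z) * ψ 1 = 0)).resolve_right hc
      linear_combination -h1
    apply hΘ
    ext z
    have h1 := hneg 1
    rw [map_one] at h1
    rw [RingEquiv.refl_apply]
    linear_combination hneg z - z * h1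
  ext z
  simp [hψ z, hψ_one]

end Suzuki

/-- Suppose `Θ` is not the identity automorphism of `F`. Let `ψ : F → F` be an additive
(`F₂`-linear) map, let `x ∈ F^×`, and let `σ` be a ring automorphism of `F`. Then the
automorphism `φ_ψ ∘ φ_x ∘ φ_σ` of `A(m,Θ)` normalizes the subgroup `A₂ = {φ_y : y ∈ F^×}`
of `Aut(A(m,Θ))` if and only if `ψ = 0`. -/
theorem Suzuki.normalizes_A2_iff (m : ℕ) (hm : 3 ≤ m) (hodd : Odd m)
    (F : Type*) [Field F] (hF : Nat.card F = 2 ^ m) (Θ : F ≃+* F)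
    (hΘ : Θ ≠ RingEquiv.refl F) (ψ : F →+ F) (x : Fˣ) (σ : F ≃+* F)
    (fψ fx fσ : MulAut (Suzuki F Θ)) (hfψ : Suzuki.IsPhiAdd Θ ψ fψ)
    (hfx : Suzuki.IsPhiMul Θ x fx) (hfσ : Suzuki.IsPhiGal Θ σ fσ) :
    (∀ f : MulAut (Suzuki F Θ),
        f ∈ Suzuki.A2 Θ ↔ (fψ * fx * fσ) * f * (fψ * fx * fσ)⁻¹ ∈ Suzuki.A2 Θ) ↔
      ψ = 0 := by
  have hσΘ := hfσ.commute
  set g := fψ * fx * fσ with hg_def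
  have hg (a b : F) : g ⟨a, b⟩ = ⟨x * σ a, ψ (x * σ a) + x * Θ x * σ b⟩ := by
    simp [hg_def, hfσ _ _, hfx _ _, hfψ _ _]
  constructor
  · intro h
    refine Suzuki.eq_zero_of_map_mul hΘ fun z a => ?_
    let y : Fˣ := Units.map (σ.symm : F →* F) z
    have hy : σ (y : F) = z := σ.apply_symm_apply _
    obtain ⟨w, hw⟩ := (h (Suzuki.phiMul Θ y)).1 ⟨y, Suzuki.isPhiMul_phiMul y⟩
    rw [Suzuki.isPhiMul_conj_iff] at hw
    have key (a : F) : (x : F) * (z * σ a) = w * (x * σ a) ∧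
        ψ (x * (z * σ a)) = w * Θ w * ψ (x * σ a) := by
      simpa [Suzuki.phiMul, hg, hy] using hw ⟨a, 0⟩
    have hwz : (w : F) = z := by
      have := (key 1).1
      rw [map_one, mul_one, mul_one, mul_comm] at this
      exact (mul_right_cancel₀ x.ne_zero this).symm
    have hψ := (key (σ.symm ((x : F)⁻¹ * a))).2
    rw [σ.apply_symm_apply, mul_inv_cancel_left₀ x.ne_zero, mul_left_comm,
      mul_inv_cancel_left₀ x.ne_zero, hwz] at hψ
    exact hψ
  · rintro rfl f
    have hconj (y : Fˣ) (p : Suzuki F Θ) :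
        g (Suzuki.phiMul Θ y p) = Suzuki.phiMul Θ (Units.map (σ : F →* F) y) (g p) := by
      obtain ⟨a, b⟩ := p
      ext <;> simp [Suzuki.phiMul, hg, hσΘ] <;> ring
    constructor
    · rintro ⟨y, hy⟩
      refine ⟨Units.map (σ : F →* F) y, (Suzuki.isPhiMul_conj_iff _ _ _).2 fun p => ?_⟩
      rw [← hconj]
      exact congrArg g (hy p.a p.b)
    · rintro ⟨w, hw⟩
      rw [Suzuki.isPhiMul_conj_iff] at hw
      refine ⟨Units.map (σ.symm : F →* F) w, fun a b => g.injective ?_⟩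
      have hw' : Units.map (σ : F →* F) (Units.map (σ.symm : F →* F) w) = w := by
        ext
        simp
      have := hconj (Units.map (σ.symm : F →* F) w) ⟨a, b⟩
      rw [hw'] at this
      exact (hw ⟨a, b⟩).trans this.symm
end

section
/- Let G be a finite group, p a prime, and P a Sylow p-subgroup of G that is not normal in G and is trivial intersection. Let N be a minimal normal subgroup of G such that p divides the order of N and N is not abelian. Then N is a simple group. -/
/-- A subgroup `P` of `G` is trivial intersection (TI) if for every `g ∈ G` either
`gPg⁻¹ = P` or `P ∩ gPg⁻¹ = 1`. -/
def IsTISubgroup {G : Type*} [Group G] (P : Subgroup G) : Prop :=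
  ∀ g : G, Subgroup.map (MulAut.conj g).toMonoidHom P = P ∨
    Subgroup.map (MulAut.conj g).toMonoidHom P ⊓ P = ⊥

open scoped Pointwise

/-- Sylow subgroups that are conjugate to a TI subgroup are equal once they share a nontrivial
element. -/
lemma IsTISubgroup.sylow_eq_of_mem {G : Type*} [Group G] [Finite G] {p : ℕ} [Fact p.Prime]
    {P : Sylow p G} (hTI : IsTISubgroup (P : Subgroup G)) {Q R : Sylow p G} {b : G} (hb : b ≠ 1)
    (hQ : b ∈ Q) (hR : b ∈ R) : Q = R := by
  obtain ⟨g, rfl⟩ := MulAction.exists_smul_eq G P Q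
  obtain ⟨h, rfl⟩ := MulAction.exists_smul_eq G P R
  have hQ' : g⁻¹ * b * g ∈ (P : Subgroup G) := by
    have : b ∈ MulAut.conj g • (P : Subgroup G) := hQ
    simpa [Subgroup.mem_pointwise_smul_iff_inv_smul_mem] using this
  have hR' : h⁻¹ * b * h ∈ (P : Subgroup G) := by
    have : b ∈ MulAut.conj h • (P : Subgroup G) := hR
    simpa [Subgroup.mem_pointwise_smul_iff_inv_smul_mem] using this
  have hmem : g⁻¹ * b * g ∈ Subgroup.map (MulAut.conj (g⁻¹ * h)).toMonoidHom (P : Subgroup G) :=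
    ⟨h⁻¹ * b * h, hR', by simp [mul_assoc]⟩
  rcases hTI (g⁻¹ * h) with heq | hbot
  · have : (g⁻¹ * h) • P = P := Sylow.ext heq
    rw [mul_smul, inv_smul_eq_iff] at this
    exact this.symm
  · have h1 : g⁻¹ * b * g ∈ (⊥ : Subgroup G) := hbot ▸ ⟨hmem, hQ'⟩
    refine absurd ?_ hb
    rw [Subgroup.mem_bot] at h1
    calc b = g * (g⁻¹ * b * g) * g⁻¹ := by group
      _ = 1 := by rw [h1]; group

/-- A Sylow subgroup conjugate to a TI subgroup is normalized by the centralizer of each of its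
nontrivial elements. -/
lemma IsTISubgroup.mem_normalizer_of_commute {G : Type*} [Group G] [Finite G] {p : ℕ}
    [Fact p.Prime] {P : Sylow p G} (hTI : IsTISubgroup (P : Subgroup G)) {Q : Sylow p G}
    {b x : G} (hb : b ≠ 1) (hQ : b ∈ Q) (hx : Commute x b) :
    x ∈ Subgroup.normalizer (Q : Set G) := by
  have hxQ : b ∈ x • Q := by
    change b ∈ MulAut.conj x • (Q : Subgroup G)
    refine ⟨b, hQ, ?_⟩
    change x * b * x⁻¹ = b
    rw [hx.eq, mul_inv_cancel_right]
  exact Sylow.smul_eq_iff_mem_normalizer.mp (hTI.sylow_eq_of_mem hb hxQ hQ)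

/-- If a finite group has a normal `p'`-subgroup `H` and a `p'`-subgroup `K`, then `K ⊔ H` is a
`p'`-subgroup. -/
lemma Subgroup.not_dvd_card_sup {G : Type*} [Group G] [Finite G] {p : ℕ} (hp : p.Prime)
    {H K : Subgroup G} [H.Normal] (hH : ¬ p ∣ Nat.card H) (hK : ¬ p ∣ Nat.card K) :
    ¬ p ∣ Nat.card (K ⊔ H : Subgroup G) := by
  rw [← Subgroup.relIndex_bot_left, ← Subgroup.relIndex_mul_relIndex ⊥ H (K ⊔ H) bot_le
    le_sup_right, Subgroup.relIndex_bot_left, Subgroup.relIndex_sup_right, hp.dvd_mul]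
  rintro (h | h)
  · exact hH h
  · exact hK (h.trans (Subgroup.relIndex_dvd_card H K))

/-- The join of a finite family of normal `p'`-subgroups is a `p'`-subgroup. -/
lemma Subgroup.not_dvd_card_iSup {G ι : Type*} [Group G] [Finite G] [Finite ι] {p : ℕ}
    (hp : p.Prime) (H : ι → Subgroup G) (hn : ∀ i, (H i).Normal)
    (hH : ∀ i, ¬ p ∣ Nat.card (H i)) : ¬ p ∣ Nat.card (⨆ i, H i : Subgroup G) := by
  have := Fintype.ofFinite ι
  rw [← Finset.sup_univ_eq_iSup]
  refine (Finset.sup_induction (p := fun K : Subgroup G => K.Normal ∧ ¬ p ∣ Nat.card K)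
    ⟨inferInstance, ?_⟩ ?_ fun i _ => ⟨hn i, hH i⟩).2
  · simpa using hp.one_lt.ne'
  · rintro K ⟨_, hK⟩ L ⟨_, hL⟩
    exact ⟨inferInstance, Subgroup.not_dvd_card_sup hp hL hK⟩

/-- A nontrivial normal subgroup of a finite group contains a minimal one. -/
lemma Subgroup.exists_minimal_normal_le {G : Type*} [Group G] [Finite G] {H : Subgroup G}
    (hH : H.Normal) (hne : H ≠ ⊥) :
    ∃ M ≤ H, M.Normal ∧ M ≠ ⊥ ∧ ∀ L : Subgroup G, L.Normal → L ≤ M → L = ⊥ ∨ L = M := by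
  obtain ⟨M, hMH, hM⟩ := (Set.toFinite {K : Subgroup G | K.Normal ∧ K ≠ ⊥}).exists_le_minimal
    (show H ∈ _ from ⟨hH, hne⟩)
  refine ⟨M, hMH, hM.prop.1, hM.prop.2, fun L hL hLM => or_iff_not_imp_left.mpr fun hLne => ?_⟩
  exact hLM.antisymm (hM.le_of_le ⟨hL, hLne⟩ hLM)

/-- The join of the conjugates under `G` of a nontrivial subgroup of a minimal normal subgroup
`N` is all of `N`. -/
lemma Subgroup.iSup_map_conjNormal_eq_top {G : Type*} [Group G] {N : Subgroup G} [N.Normal]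
    (hmin : ∀ K : Subgroup G, K.Normal → K ≤ N → K = ⊥ ∨ K = N) {M : Subgroup N} (hM : M ≠ ⊥) :
    ⨆ g : G, M.map (MulAut.conjNormal g : MulAut N).toMonoidHom = ⊤ := by
  set S := ⨆ g : G, M.map (MulAut.conjNormal g : MulAut N).toMonoidHom with hS
  have hSinv : ∀ g : G, S.map (MulAut.conjNormal g : MulAut N).toMonoidHom ≤ S := by
    intro g
    rw [hS, Subgroup.map_iSup]
    refine iSup_le fun h => ?_
    rw [Subgroup.map_map]
    refine le_trans (le_of_eq ?_)
      (le_iSup (fun g : G => M.map (MulAut.conjNormal g : MulAut N).toMonoidHom) (g * h))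
    congr 1
    ext x
    simp [mul_assoc]
  have hMS : M ≤ S := by
    refine le_trans (le_of_eq ?_)
      (le_iSup (fun g : G => M.map (MulAut.conjNormal g : MulAut N).toMonoidHom) 1)
    ext x
    simp
  have hnormal : (S.map N.subtype).Normal := by
    refine ⟨?_⟩
    rintro _ ⟨x, hx, rfl⟩ g
    exact ⟨MulAut.conjNormal g x, hSinv g ⟨x, hx, rfl⟩, by simp⟩
  rcases hmin _ hnormal (Subgroup.map_subtype_le S) with h | h
  · rw [Subgroup.map_eq_bot_iff_of_injective _ N.subtype_injective] at h
    exact absurd (le_bot_iff.mp (h ▸ hMS)) hM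
  · refine Subgroup.map_injective N.subtype_injective ?_
    rw [h, ← MonoidHom.range_eq_map, Subgroup.range_subtype]

/-- Let `G` be a finite group, `p` a prime, and `P` a Sylow `p`-subgroup of `G` that is not
normal in `G` and is trivial intersection. Let `N` be a minimal normal subgroup of `G` such
that `p` divides the order of `N` and `N` is not abelian. Then `N` is a simple group. -/
theorem minimal_normal_is_simple (G : Type*) [Group G] [Finite G] (p : ℕ) [Fact p.Prime]
    (P : Sylow p G) (hnn : ¬ (P : Subgroup G).Normal) (hTI : IsTISubgroup (P : Subgroup G))
    (N : Subgroup G) (hN : N.Normal) (hbot : N ≠ ⊥)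
    (hmin : ∀ K : Subgroup G, K.Normal → K ≤ N → K = ⊥ ∨ K = N)
    (hp : p ∣ Nat.card N)
    (hnab : ¬ ∀ x ∈ N, ∀ y ∈ N, x * y = y * x) :
    IsSimpleGroup N := by
  have hpp : p.Prime := Fact.out
  have : Nontrivial N := N.nontrivial_iff_ne_bot.mpr hbot
  refine ⟨fun H hH => or_iff_not_imp_left.mpr fun hHne => ?_⟩
  obtain ⟨M, hMH, hM, hMne, hMmin⟩ := Subgroup.exists_minimal_normal_le hH hHne
  refine top_le_iff.mp (le_trans (top_le_iff.mpr ?_) hMH)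
  set c : G → Subgroup N := fun g => M.map (MulAut.conjNormal g : MulAut N).toMonoidHom with hc
  have hctop : ⨆ g, c g = ⊤ := Subgroup.iSup_map_conjNormal_eq_top hmin hMne
  have hcn : ∀ g, (c g).Normal := fun g => hM.map _ (MulEquiv.surjective _)
  have hccard : ∀ g, Nat.card (c g) = Nat.card M := fun g =>
    Subgroup.card_map_of_injective (MulEquiv.injective _)
  have hcM : ∀ g, c g = M ∨ Disjoint M (c g) := by
    intro g
    have := hcn g
    rcases hMmin (M ⊓ c g) inferInstance inf_le_left with h | h
    · exact Or.inr (disjoint_iff.mpr h)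
    · exact Or.inl (Subgroup.eq_of_le_of_card_ge (inf_eq_left.mp h) (hccard g).le).symm
  have hpM : p ∣ Nat.card M := by
    by_contra hnot
    refine Subgroup.not_dvd_card_iSup hpp c hcn (fun g => by rwa [hccard]) ?_
    rwa [hctop, Subgroup.card_top]
  by_contra hMtop
  obtain ⟨g, hg⟩ : ∃ g, Disjoint M (c g) := by
    by_contra! hnone
    refine hMtop (hctop ▸ ?_)
    rw [iSup_congr fun g => (hcM g).resolve_right (hnone g), iSup_const]
  obtain ⟨a, ha⟩ := exists_prime_orderOf_dvd_card' p hpM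
  obtain ⟨b, hb⟩ := exists_prime_orderOf_dvd_card' p (hccard g ▸ hpM)
  have hcomm : ∀ h, Disjoint M (c h) → ∀ x ∈ M, ∀ y ∈ c h, Commute (x : G) (y : G) :=
    fun h hd x hx y hy =>
      (Subgroup.commute_of_normal_of_disjoint M (c h) hM (hcn h) hd x y hx hy).map N.subtype
  have ha' : orderOf ((a : N) : G) = p := by simpa using ha
  have hb' : orderOf ((b : N) : G) = p := by simpa using hb
  have ne_one_of_order : ∀ x : G, orderOf x = p → x ≠ 1 := by
    rintro x hx rfl
    exact hpp.one_lt.ne (by simpa using hx)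
  have isPGroup_of_order : ∀ x : G, orderOf x = p → IsPGroup p (Subgroup.zpowers x) :=
    fun x hx => IsPGroup.of_card (n := 1) (by rw [Nat.card_zpowers, hx, pow_one])
  have hab : Commute ((a : N) : G) ((b : N) : G) := hcomm g hg a a.2 b b.2
  obtain ⟨Q, hQ⟩ : ∃ Q : Sylow p G,
      Subgroup.zpowers ((a : N) : G) ⊔ Subgroup.zpowers ((b : N) : G) ≤ Q := by
    refine (IsPGroup.to_sup_of_normal_right' (isPGroup_of_order _ ha')
      (isPGroup_of_order _ hb') ?_).exists_le_sylow
    refine le_trans ?_ (Subgroup.centralizer_le_normalizer _)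
    rw [Subgroup.zpowers_le, Subgroup.mem_centralizer_iff]
    rintro _ ⟨k, rfl⟩
    exact (hab.zpow_right k).eq.symm
  have haQ : ((a : N) : G) ∈ Q := hQ (Subgroup.mem_sup_left (Subgroup.mem_zpowers _))
  have hbQ : ((b : N) : G) ∈ Q := hQ (Subgroup.mem_sup_right (Subgroup.mem_zpowers _))
  have hNQ : N ≤ Subgroup.normalizer (Q : Set G) := by
    rw [← Subgroup.subgroupOf_eq_top, ← top_le_iff, ← hctop]
    refine iSup_le fun h x hx => ?_
    rw [Subgroup.mem_subgroupOf]
    rcases hcM h with hh | hh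
    · exact hTI.mem_normalizer_of_commute (ne_one_of_order _ hb') hbQ
        (hcomm g hg x (hh ▸ hx) b b.2)
    · exact hTI.mem_normalizer_of_commute (ne_one_of_order _ ha') haQ
        (hcomm h hh a a.2 x hx).symm
  have hfix : ∀ x : G, x • Q = Q := by
    intro x
    have hord : orderOf (x * ((a : N) : G) * x⁻¹) = p := by
      rw [← ha']
      exact orderOf_injective (MulAut.conj x).toMonoidHom (MulAut.conj x).injective _
    have hmem : x * ((a : N) : G) * x⁻¹ ∈ Q := by
      have h : x * ((a : N) : G) * x⁻¹ ∈
          Subgroup.zpowers (x * ((a : N) : G) * x⁻¹) ⊓ Subgroup.normalizer (Q : Set G) :=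
        ⟨Subgroup.mem_zpowers _, hNQ (hN.conj_mem _ (a : N).2 x)⟩
      rw [(isPGroup_of_order _ hord).inf_normalizer_sylow Q] at h
      exact h.2
    exact hTI.sylow_eq_of_mem (ne_one_of_order _ hord) ⟨_, haQ, rfl⟩ hmem
  obtain ⟨y, rfl⟩ := MulAction.exists_smul_eq G Q P
  rw [hfix y] at hnn
  exact hnn (Subgroup.normalizer_eq_top_iff.mp
    (eq_top_iff.mpr fun x _ => Sylow.smul_eq_iff_mem_normalizer.mp (hfix x)))
end

section
/- Let G be a finite group, p a prime, P a Sylow p-subgroup of G that is trivial intersection, and N a normal subgroup of G. Then P ∩ N is a Sylow p-subgroup of N, and P ∩ N is trivial intersection as a Sylow p-subgroup of N: for every x ∈ N, either x(P∩N)x⁻¹ = P∩N or (P∩N) ∩ x(P∩N)x⁻¹ = 1. -/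
/-- The intersection of a Sylow subgroup with a normal subgroup is a Sylow subgroup of the latter. -/
theorem Sylow.exists_eq_subgroupOf_normal {G : Type*} [Group G] {p : ℕ} [Fact p.Prime]
    [Finite (Sylow p G)] (P : Sylow p G) (N : Subgroup G) [N.Normal] :
    ∃ Q : Sylow p N, (Q : Subgroup N) = (P : Subgroup G).subgroupOf N := by
  obtain ⟨Q⟩ : Nonempty (Sylow p N) := inferInstance
  obtain ⟨R, hR⟩ := Q.exists_comap_subtype_eq
  obtain ⟨g, rfl⟩ := MulAction.exists_smul_eq G P R
  refine ⟨(MulAut.conjNormal g⁻¹ : MulAut N) • Q, ?_⟩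
  ext x
  rw [Sylow.pointwise_smul_def, Subgroup.mem_pointwise_smul_iff_inv_smul_mem, ← hR,
    Subgroup.mem_comap, Sylow.coe_subgroup_smul, Subgroup.mem_pointwise_smul_iff_inv_smul_mem,
    Subgroup.mem_subgroupOf]
  simp [mul_assoc]

/-- Restricting a trivial intersection subgroup to any subgroup gives a trivial intersection
subgroup. -/
theorem IsTISubgroup.subgroupOf {G : Type*} [Group G] {P : Subgroup G} (hP : IsTISubgroup P)
    (N : Subgroup G) : IsTISubgroup (P.subgroupOf N) := by
  intro x
  have hmap : Subgroup.map (MulAut.conj x).toMonoidHom (P.subgroupOf N) =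
      (Subgroup.map (MulAut.conj (x : G)).toMonoidHom P).subgroupOf N := by
    ext y
    rw [Subgroup.mem_subgroupOf, Subgroup.mem_map_equiv, Subgroup.mem_map_equiv,
      Subgroup.mem_subgroupOf]
    simp
  rw [hmap]
  refine (hP x).imp (fun h => by rw [h]) fun h => ?_
  rw [Subgroup.subgroupOf, Subgroup.subgroupOf, ← Subgroup.comap_inf, h]
  exact Subgroup.bot_subgroupOf N

/-- Let `G` be a finite group, `p` a prime, `P` a Sylow `p`-subgroup of `G` that is trivial
intersection, and `N` a normal subgroup of `G`. Then `P ∩ N` is a Sylow `p`-subgroup of `N`,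
and `P ∩ N` is trivial intersection as a Sylow `p`-subgroup of `N`: for every `x ∈ N`, either
`x(P∩N)x⁻¹ = P∩N` or `(P∩N) ∩ x(P∩N)x⁻¹ = 1`. -/
theorem sylow_inter_normal_TI (G : Type*) [Group G] [Finite G] (p : ℕ) [Fact p.Prime]
    (P : Sylow p G) (hTI : IsTISubgroup (P : Subgroup G))
    (N : Subgroup G) (hN : N.Normal) :
    (∃ Q : Sylow p N, (Q : Subgroup N) = (P : Subgroup G).subgroupOf N) ∧
    IsTISubgroup ((P : Subgroup G).subgroupOf N) := by
  exact ⟨P.exists_eq_subgroupOf_normal N, hTI.subgroupOf N⟩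
end
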